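/- For every game G, every K ∈ ℤ+, and all S, T ∈ ℕ, the non-uniform security of the salted game satisfies the additive bound ε_{G_K}(S, T) ≤ ε_G(T) + 4·√(S/K). -/

import Mathlib

open scoped ENNReal BigOperators

noncomputable section

/-- `{0,1}`-valued indicator of a proposition, in `ℝ≥0∞`. -/
def ind (p : Prop) : ℝ≥0∞ :=
  haveI := Classical.propDecidable p
  if p then 1 else 0

/-- Deterministic oracle algorithms making at most `T` queries, modeled as decision
trees of depth at most `T`: a query is an element `q : Q`, the oracle's answer to `q`
has type `Ans q`, and the final output has type `O`. -/
inductive DT (Q : Type) (Ans : Q → Type) (O : Type) : ℕ → Type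
  | ret {T : ℕ} (o : O) : DT Q Ans O T
  | query {T : ℕ} (q : Q) (cont : Ans q → DT Q Ans O T) : DT Q Ans O (T + 1)

/-- Run a decision tree against an oracle. -/
def DT.run {Q : Type} {Ans : Q → Type} {O : Type} :
    {T : ℕ} → DT Q Ans O T → ((q : Q) → Ans q) → O
  | _, DT.ret o, _ => o
  | _, DT.query q cont, f => DT.run (cont (f q)) f

/-- The number of queries satisfying `p` made along the execution path on oracle `f`. -/
def DT.countP {Q : Type} {Ans : Q → Type} {O : Type} (p : Q → Prop) :
    {T : ℕ} → DT Q Ans O T → ((q : Q) → Ans q) → ℕ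
  | _, DT.ret _, _ => 0
  | _, DT.query q cont, f =>
      (haveI := Classical.propDecidable (p q); if p q then 1 else 0)
        + DT.countP p (cont (f q)) f

/-- A (single-challenge) game: an oracle distribution `μ` over functions
`Fin M → Fin N`, a challenge distribution `π f` for each oracle `f`, and an
accepting outcome set `R f ch` for each oracle and challenge. -/
structure Game where
  M : ℕ
  N : ℕ
  hM : 0 < M
  hN : 0 < N
  Ch : Type
  chFin : Fintype Ch
  Out : Type
  μ : PMF (Fin M → Fin N)
  π : (Fin M → Fin N) → PMF Ch
  R : (Fin M → Fin N) → Ch → Set Out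

attribute [instance] Game.chFin

namespace Game

variable (G : Game)

/-- Winning probability of a deterministic `T`-query algorithm (taking the challenge
as classical input) for the game `G`. -/
def detWinProb {T : ℕ} (a : G.Ch → DT (Fin G.M) (fun _ => Fin G.N) G.Out T) : ℝ≥0∞ :=
  ∑' f : Fin G.M → Fin G.N, G.μ f * ∑' ch : G.Ch, G.π f ch * ind ((a ch).run f ∈ G.R f ch)

/-- Uniform security `ε_G(T)`: the supremum, over randomized `T`-query algorithms
(probability distributions over deterministic ones), of the winning probability. -/
def unifSec (T : ℕ) : ℝ≥0∞ :=
  ⨆ A : PMF (G.Ch → DT (Fin G.M) (fun _ => Fin G.N) G.Out T),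
    ∑' a, A a * G.detWinProb a

/-- Winning probability, in the salted game `G_K`, of a non-uniform algorithm:
a randomized `T`-query algorithm `A` receiving `S` bits of advice together with the
salt and challenge, and an advice function `adv` mapping the joint oracle to `S` bits.
The joint oracle consists of `K` i.i.d. copies `g 0, …, g (K-1)` of the oracle of `G`,
the salt `k` is uniform on `Fin K` and the challenge is drawn from `π (g k)`. -/
def saltedWinProb (K S T : ℕ)
    (A : PMF ((Fin S → Bool) × Fin K × G.Ch →
      DT (Fin K × Fin G.M) (fun _ => Fin G.N) G.Out T))
    (adv : (Fin K → Fin G.M → Fin G.N) → Fin S → Bool) : ℝ≥0∞ :=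
  ∑' g : Fin K → Fin G.M → Fin G.N,
    (∏ k, G.μ (g k)) *
      ((K : ℝ≥0∞)⁻¹ *
        ∑' k : Fin K, ∑' ch : G.Ch, G.π (g k) ch *
          ∑' a, A a *
            ind ((a (adv g, k, ch)).run (fun q => g q.1 q.2) ∈ G.R (g k) ch))

/-- Non-uniform security `ε_{G_K}(S,T)` of the salted game `G_K`: the supremum of the
winning probability over all non-uniform `(S,T)`-algorithms `(A, adv)`. -/
def saltedNonunifSec (K S T : ℕ) : ℝ≥0∞ :=
  ⨆ (A : PMF ((Fin S → Bool) × Fin K × G.Ch →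
      DT (Fin K × Fin G.M) (fun _ => Fin G.N) G.Out T))
    (adv : (Fin K → Fin G.M → Fin G.N) → Fin S → Bool),
    G.saltedWinProb K S T A adv

/-- The marginal probability of a challenge `ch` (for `f ∼ μ`, `ch ∼ π f`). -/
def chProb (ch : G.Ch) : ℝ≥0∞ := ∑' f : Fin G.M → Fin G.N, G.μ f * G.π f ch

/-- The oracle distribution `μ_ch` conditioned on the drawn challenge being `ch`. -/
def condDist (ch : G.Ch) (f : Fin G.M → Fin G.N) : ℝ≥0∞ :=
  G.μ f * G.π f ch / G.chProb ch

/-- Uniform security `ε_{G_ch}(T)` of the challenge-conditioned plain game `G_ch`: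
the supremum over randomized `T`-query algorithms of the probability, for
`f ∼ μ_ch`, that the output lies in `R f ch`. -/
def condSec (ch : G.Ch) (T : ℕ) : ℝ≥0∞ :=
  ⨆ A : PMF (DT (Fin G.M) (fun _ => Fin G.N) G.Out T),
    ∑' a, A a * ∑' f : Fin G.M → Fin G.N, G.condDist ch f * ind (a.run f ∈ G.R f ch)

/-- Uniform security `ε_{G^n}(T')` of the multi-challenge game `G^n`: `n` i.i.d.
challenges are drawn from `π f` and the algorithm must answer all of them. -/
def multiSec (n T' : ℕ) : ℝ≥0∞ :=
  ⨆ A : PMF ((Fin n → G.Ch) → DT (Fin G.M) (fun _ => Fin G.N) (Fin n → G.Out) T'),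
    ∑' a, A a * ∑' f : Fin G.M → Fin G.N, G.μ f *
      ∑' chs : Fin n → G.Ch,
        (∏ j, G.π f (chs j)) * ind (∀ j, (a chs).run f j ∈ G.R f (chs j))

end Game

/-- A plain game: a game without challenges. -/
structure PlainGame where
  M : ℕ
  N : ℕ
  hM : 0 < M
  hN : 0 < N
  Out : Type
  μ : PMF (Fin M → Fin N)
  R : (Fin M → Fin N) → Set Out

namespace PlainGame

/-- Uniform security `ε_G(T)` of a plain game. -/
def unifSec (G : PlainGame) (T : ℕ) : ℝ≥0∞ :=
  ⨆ A : PMF (DT (Fin G.M) (fun _ => Fin G.N) G.Out T),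
    ∑' a, A a * ∑' f : Fin G.M → Fin G.N, G.μ f * ind (a.run f ∈ G.R f)

end PlainGame

/-- Query domain for joint oracle access to the oracles of `k` plain games:
each query is addressed to one of the oracles. -/
abbrev ProdQ {k : ℕ} (Gs : Fin k → PlainGame) : Type := (i : Fin k) × Fin (Gs i).M

/-- Answer type for queries in the direct product. -/
abbrev ProdAns {k : ℕ} (Gs : Fin k → PlainGame) : ProdQ Gs → Type :=
  fun q => Fin (Gs q.1).N

/-- The joint oracle `(f 0, …, f (k-1))` as a single oracle function. -/
def jointOracle {k : ℕ} {Gs : Fin k → PlainGame}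
    (f : (i : Fin k) → Fin (Gs i).M → Fin (Gs i).N) : (q : ProdQ Gs) → ProdAns Gs q :=
  fun q => f q.1 q.2

/-- Winning probability of a `(T 0, …, T (k-1))`-memoryless algorithm, given by
deterministic algorithms `A i` (each making at most `T i` queries and each with
joint oracle access) run sequentially with no shared memory; the oracles are drawn
independently, and the algorithm wins if every output `(A i).run` is accepted. -/
def memorylessWinProb {k : ℕ} (Gs : Fin k → PlainGame) {T : Fin k → ℕ}
    (A : (i : Fin k) → DT (ProdQ Gs) (ProdAns Gs) (Gs i).Out (T i)) : ℝ≥0∞ :=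
  ∑' f : (i : Fin k) → Fin (Gs i).M → Fin (Gs i).N,
    (∏ i, (Gs i).μ (f i)) * ind (∀ i, (A i).run (jointOracle f) ∈ (Gs i).R (f i))

/-- Winning probability of a deterministic algorithm with joint oracle access
outputting a tuple `(e 0, …, e (k-1))` for the direct product game. -/
def jointWinProb {k : ℕ} (Gs : Fin k → PlainGame) {B : ℕ}
    (A : DT (ProdQ Gs) (ProdAns Gs) ((i : Fin k) → (Gs i).Out) B) : ℝ≥0∞ :=
  ∑' f : (i : Fin k) → Fin (Gs i).M → Fin (Gs i).N,
    (∏ i, (Gs i).μ (f i)) * ind (∀ i, A.run (jointOracle f) i ∈ (Gs i).R (f i))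

/-- A deterministic algorithm is `(T 0, …, T (k-1))`-fair if in every execution it
makes at most `T i` queries to the `i`-th oracle. -/
def IsFair {k : ℕ} {Gs : Fin k → PlainGame} {O : Type} {B : ℕ} (T : Fin k → ℕ)
    (A : DT (ProdQ Gs) (ProdAns Gs) O B) : Prop :=
  ∀ (f : (i : Fin k) → Fin (Gs i).M → Fin (Gs i).N) (i : Fin k),
    A.countP (fun q => q.1 = i) (jointOracle f) ≤ T i

end

section DirectProduct

variable {ι X Y O : Type}

/-- A finite sum of suprema over a common type is a supremum over choice functions. -/
theorem ENNReal.sum_iSup_le_iSup_sum {α β : Type*} (s : Finset β) (φ : β → α → ℝ≥0∞) :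
    ∑ b ∈ s, ⨆ x, φ b x ≤ ⨆ c : β → α, ∑ b ∈ s, φ b (c b) := by
  rw [← ENNReal.finsetSum_iSup (f := fun b (c : β → α) => φ b (c b))]
  · exact Finset.sum_le_sum fun b _ => iSup_le fun x =>
      le_iSup (fun c : β → α => φ b (c b)) fun _ => x
  · intro c c'
    refine ⟨fun b => if φ b (c b) ≤ φ b (c' b) then c' b else c b, fun b => ?_⟩
    by_cases h : φ b (c b) ≤ φ b (c' b)
    · simp [h]
    · simp [h, (not_le.mp h).le]

variable [Fintype X] [DecidableEq X] [Fintype Y] [DecidableEq Y]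

/-- The largest expected payoff `w` of a decision tree of depth at most `t`, for an oracle
drawn from the (unnormalised) distribution `D`. -/
noncomputable def DT.optVal (w : (X → Y) → O → ℝ≥0∞) (t : ℕ) (D : (X → Y) → ℝ≥0∞) : ℝ≥0∞ :=
  ⨆ B : DT X (fun _ => Y) O t, ∑ f, D f * w f (B.run f)

theorem DT.sum_optVal_query_le (w : (X → Y) → O → ℝ≥0∞) (t : ℕ) (D : (X → Y) → ℝ≥0∞) (x : X) :
    ∑ b, DT.optVal w t (fun f => if f x = b then D f else 0) ≤ DT.optVal w (t + 1) D := by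
  refine (ENNReal.sum_iSup_le_iSup_sum _ _).trans (iSup_le fun c => ?_)
  refine le_trans (le_of_eq ?_)
    (le_iSup (fun B : DT X (fun _ => Y) O (t + 1) => ∑ f, D f * w f (B.run f)) (.query x c))
  rw [Finset.sum_comm]
  refine Finset.sum_congr rfl fun f _ => ?_
  simp [DT.run]

theorem DT.sum_optVal_const_le (w : (X → Y) → O → ℝ≥0∞) (t : ℕ) (D : (X → Y) → ℝ≥0∞) (d : Y) :
    ∑ b, DT.optVal w t (fun f => if d = b then D f else 0) ≤ DT.optVal w t D := by
  rw [Finset.sum_eq_single d (by intro b _ hb; simp [DT.optVal, hb.symm]) (by simp)]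
  simp

/-- A self-map on a nonempty finite set which possibly leaves the set has a nonempty subset on
which it is injective and which is mapped into itself or out of the whole set. -/
theorem Finset.exists_injOn_mapsTo_or_notMem [DecidableEq ι] (L : Finset ι) (hL : L.Nonempty)
    (σ : ι → ι) :
    ∃ C ⊆ L, C.Nonempty ∧ Set.InjOn σ C ∧ ∀ i ∈ C, σ i ∈ C ∨ σ i ∉ L := by
  by_cases h : ∃ i ∈ L, σ i ∉ L
  · obtain ⟨i, hi, hσ⟩ := h
    exact ⟨{i}, by simpa using hi, by simp, by simp, by simp [hσ]⟩
  · push Not at h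
    induction L using Finset.strongInduction with
    | H L ih =>
      have hsub : L.image σ ⊆ L := Finset.image_subset_iff.mpr h
      by_cases heq : L.image σ = L
      · exact ⟨L, subset_rfl, hL, Finset.card_image_iff.mp (by rw [heq]), fun i hi => .inl (h i hi)⟩
      · obtain ⟨C, hC, hne, hinj, hmap⟩ := ih _ (hsub.ssubset_of_ne heq) (hL.image σ)
          fun i hi => Finset.mem_image_of_mem σ (hsub hi)
        exact ⟨C, hC.trans hsub, hne, hinj, fun i hi => .inl <| (hmap i hi).resolve_right
          fun hn => hn (Finset.mem_image_of_mem σ (hsub (hC hi)))⟩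

variable [Fintype ι] [DecidableEq ι]

/-- Direct product bound: algorithm `i` has access to all of the independent oracles and receives
a payoff depending on oracle `i`, for `i` in `L`. The expected product of the payoffs is
at most the product of the single-oracle optima. -/
theorem DT.sum_prod_le_prod_optVal_aux [Nonempty X] [Inhabited Y] (w : ι → (X → Y) → O → ℝ≥0∞)
    (n : ℕ) : ∀ (L : Finset ι) (A : ι → Σ t, DT (ι × X) (fun _ => Y) O t)
      (D : ι → (X → Y) → ℝ≥0∞), ∑ i ∈ L, ((A i).1 + 1) = n →
      ∑ g : ι → X → Y, ∏ i, (D i (g i) *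
          if i ∈ L then w i (g i) ((A i).2.run fun q => g q.1 q.2) else 1) ≤
        ∏ i, if i ∈ L then DT.optVal (w i) (A i).1 (D i) else ∑ f, D i f := by
  induction n using Nat.strong_induction_on with
  | _ n ih =>
  intro L A D hn
  by_cases hret : ∃ j ∈ L, ∃ t o, A j = ⟨t, .ret o⟩
  · obtain ⟨j, hj, t, o, hA⟩ := hret
    have hlt : ∑ i ∈ L.erase j, ((A i).1 + 1) < n := by
      rw [← hn, ← Finset.add_sum_erase L _ hj]; omega
    refine le_trans (le_of_eq ?_) ((ih _ hlt (L.erase j) A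
      (Function.update D j fun f => D j f * w j f o) rfl).trans ?_)
    · refine Finset.sum_congr rfl fun g _ => Finset.prod_congr rfl fun i _ => ?_
      by_cases hij : i = j
      · subst hij; rw [hA]; simp [hj, DT.run]
      · simp [hij]
    · refine Finset.prod_le_prod' fun i _ => ?_
      by_cases hij : i = j
      · subst hij
        simp only [Finset.notMem_erase, if_false, hj, if_true, Function.update_self, hA]
        exact le_iSup (fun B : DT X (fun _ => Y) O t => ∑ f, D i f * w i f (B.run f)) (.ret o)
      · simp [hij]
  rcases L.eq_empty_or_nonempty with rfl | hL
  · simp [Finset.prod_univ_sum]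
  have hquery : ∀ i, ∃ (q : ι × X) (t : ℕ) (c : Y → DT (ι × X) (fun _ => Y) O t),
      i ∈ L → A i = ⟨t + 1, .query q c⟩ := by
    intro i
    by_cases hi : i ∈ L
    · rcases hAi : A i with ⟨t, B⟩
      cases B with
      | ret o => exact absurd ⟨i, hi, t, o, hAi⟩ hret
      | query q c => exact ⟨q, _, c, fun _ => rfl⟩
    · rcases (A i).2.run fun _ => default with o
      exact ⟨(i, Classical.arbitrary X), 0, fun _ => .ret o, fun h => absurd h hi⟩
  choose q t c hA using hquery
  obtain ⟨C, hCL, hCne, hinj, hC⟩ := L.exists_injOn_mapsTo_or_notMem hL fun i => (q i).1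
  have : Nonempty ι := ⟨hCne.choose⟩
  let y : ι → X := fun j => (q (Function.invFunOn (fun i => (q i).1) C j)).2
  have hy : ∀ i ∈ C, y (q i).1 = (q i).2 := fun i hi => by
    simp only [y]
    rw [hinj.leftInvOn_invFunOn (show i ∈ (C : Set ι) from hi)]
  let key : ι → (X → Y) → Y := fun j f => if j ∈ L \ C then default else f (y j)
  have hkey : ∀ i ∈ C, ∀ f, key (q i).1 f = f (q i).2 := fun i hi f => by
    have : (q i).1 ∉ L \ C := by
      rw [Finset.mem_sdiff]; rcases hC i hi with h | h <;> tauto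
    simp only [key, if_neg this, hy i hi]
  let A' : (ι → Y) → ι → Σ t, DT (ι × X) (fun _ => Y) O t := fun b i =>
    if i ∈ C then ⟨t i, c i (b (q i).1)⟩ else A i
  have hA'C : ∀ b, ∀ i ∈ C, A' b i = ⟨t i, c i (b (q i).1)⟩ := fun b i hi => if_pos hi
  have hA'nC : ∀ b, ∀ i ∉ C, A' b i = A i := fun b i hi => if_neg hi
  let D' : ι → Y → (X → Y) → ℝ≥0∞ := fun i y f => if key i f = y then D i f else 0
  let t' : ι → ℕ := fun i => if i ∈ C then t i else (A i).1
  have ht' : ∀ b i, (A' b i).1 = t' i := fun b i => by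
    by_cases hi : i ∈ C <;> simp [A', t', hi]
  calc
    _ ≤ ∑ g : ι → X → Y, ∑ b : ι → Y, ∏ i, (D' i (b i) (g i) *
          if i ∈ L then w i (g i) ((A' b i).2.run fun q => g q.1 q.2) else 1) := by
      refine Finset.sum_le_sum fun g _ => ?_
      refine le_trans (le_of_eq ?_)
        (Finset.single_le_sum (fun _ _ => zero_le) (Finset.mem_univ fun i => key i (g i)))
      refine Finset.prod_congr rfl fun i _ => ?_
      simp only [D', if_true]
      by_cases hi : i ∈ C
      · rw [hA i (hCL hi), hA'C (fun i => key i (g i)) i hi]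
        simp [hCL hi, DT.run, hkey i hi]
      · rw [hA'nC (fun i => key i (g i)) i hi]
    _ = ∑ b : ι → Y, ∑ g : ι → X → Y, ∏ i, (D' i (b i) (g i) *
          if i ∈ L then w i (g i) ((A' b i).2.run fun q => g q.1 q.2) else 1) := Finset.sum_comm
    _ ≤ ∑ b : ι → Y, ∏ i, if i ∈ L then DT.optVal (w i) (t' i) (D' i (b i))
          else ∑ f, D' i (b i) f := by
      refine Finset.sum_le_sum fun b _ => ?_
      have hlt : ∑ i ∈ L, ((A' b i).1 + 1) < n := by
        rw [← hn]
        obtain ⟨i, hi⟩ := hCne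
        refine Finset.sum_lt_sum (fun k hk => ?_) ⟨i, hCL hi, ?_⟩
        · by_cases hkC : k ∈ C <;> simp [A', hkC, hA k hk]
        · simp [A', hi, hA i (hCL hi)]
      simpa only [ht'] using ih _ hlt L (A' b) (fun i => D' i (b i)) rfl
    _ = ∏ i, ∑ z, if i ∈ L then DT.optVal (w i) (t' i) (D' i z) else ∑ f, D' i z f := by
      rw [Finset.prod_univ_sum, Fintype.piFinset_univ]
    _ ≤ _ := by
      refine Finset.prod_le_prod' fun i _ => ?_
      by_cases hi : i ∈ L
      · simp only [hi, if_true]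
        by_cases hiC : i ∈ C
        · simp only [D', key, t', hiC, hi, hA i hi, Finset.mem_sdiff, not_true, and_false,
            if_false, if_true]
          exact DT.sum_optVal_query_le _ _ _ _
        · simp only [D', key, t', hiC, hi, Finset.mem_sdiff, not_false_eq_true, and_true,
            if_false, if_true]
          exact DT.sum_optVal_const_le _ _ _ _
      · simp only [hi, if_false]
        rw [Finset.sum_comm]
        simp [D']

/-- Direct product bound for algorithms with access to all of the independent oracles,
each receiving a payoff depending on its own oracle. -/
theorem DT.sum_prod_le_prod_optVal [Nonempty X] [Inhabited Y] (w : ι → (X → Y) → O → ℝ≥0∞)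
    (T : ℕ) (A : ι → DT (ι × X) (fun _ => Y) O T) (D : ι → (X → Y) → ℝ≥0∞) :
    ∑ g : ι → X → Y, ∏ i, (D i (g i) * w i (g i) ((A i).run fun q => g q.1 q.2)) ≤
      ∏ i, DT.optVal (w i) T (D i) := by
  simpa using DT.sum_prod_le_prod_optVal_aux w _ Finset.univ (fun i => ⟨T, A i⟩) D rfl

end DirectProduct

theorem ind_le_one (p : Prop) : ind p ≤ 1 := by
  unfold ind; split_ifs <;> simp

namespace Real

theorem exp_mul_le_one_add (l z : ℝ) (h0 : 0 ≤ z) (h1 : z ≤ 1) :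
    exp (l * z) ≤ 1 + (exp l - 1) * z := by
  have := convexOn_exp.2 (Set.mem_univ 0) (Set.mem_univ l) (sub_nonneg.mpr h1) h0 (by ring)
  simp only [smul_eq_mul, mul_zero, zero_add, exp_zero, mul_one] at this
  rw [mul_comm l z]
  linarith

/-- If the generating functions of the sums `∑ k, Z s g k` are dominated by those of binomial
variables, then the expected value of the best (over `2 ^ S` choices of `s`) sum exceeds the
binomial mean by at most the stated amount. -/
theorem mean_max_le_of_generating_le {Ω α : Type*} [Fintype Ω] [Fintype α] (K S : ℕ)
    (hK : 0 < K) (hα : Fintype.card α = 2 ^ S) (p : Ω → ℝ) (hp : ∀ g, 0 ≤ p g)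
    (hp1 : ∑ g, p g = 1) (Z : α → Ω → Fin K → ℝ) (hZ0 : ∀ s g k, 0 ≤ Z s g k)
    (hZ1 : ∀ s g k, Z s g k ≤ 1) (ε : ℝ) (hε0 : 0 ≤ ε) (hε1 : ε ≤ 1)
    (hgen : ∀ s, ∀ c : ℝ, 0 ≤ c → ∑ g, p g * ∏ k, (1 + c * Z s g k) ≤ (1 + c * ε) ^ K)
    (adv : Ω → α) (l : ℝ) (hl0 : 0 < l) (hl1 : l ≤ 1) :
    ∑ g, p g * ((K : ℝ)⁻¹ * ∑ k, Z (adv g) g k) ≤ ε + l + S / (l * K) := by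
  have hKR : (0 : ℝ) < K := by exact_mod_cast hK
  have hc : 0 ≤ exp l - 1 := by linarith [add_one_le_exp l]
  have hc' : exp l - 1 ≤ l + l ^ 2 := by
    have := (abs_le.mp (abs_exp_sub_one_sub_id_le (x := l) (by rwa [abs_of_pos hl0]))).2
    linarith
  have key : exp (∑ g, p g * (l * ∑ k, Z (adv g) g k)) ≤ exp (S + (exp l - 1) * ε * K) := calc
    _ ≤ ∑ g, p g * exp (l * ∑ k, Z (adv g) g k) := by
      simpa using convexOn_exp.map_sum_le (t := Finset.univ) (w := p)
        (p := fun g => l * ∑ k, Z (adv g) g k) (fun g _ => hp g) hp1 (by simp)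
    _ ≤ ∑ g, p g * ∑ s, ∏ k, (1 + (exp l - 1) * Z s g k) := by
      refine Finset.sum_le_sum fun g _ => mul_le_mul_of_nonneg_left ?_ (hp g)
      have hnn : ∀ s k, 0 ≤ 1 + (exp l - 1) * Z s g k := fun s k =>
        add_nonneg zero_le_one (mul_nonneg hc (hZ0 s g k))
      refine le_trans ?_ (Finset.single_le_sum (fun s _ => Finset.prod_nonneg fun k _ => hnn s k)
        (Finset.mem_univ (adv g)))
      rw [Finset.mul_sum, exp_sum]
      exact Finset.prod_le_prod (fun _ _ => (exp_pos _).le)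
        fun k _ => exp_mul_le_one_add _ _ (hZ0 _ _ _) (hZ1 _ _ _)
    _ = ∑ s, ∑ g, p g * ∏ k, (1 + (exp l - 1) * Z s g k) := by
      simp_rw [Finset.mul_sum]
      exact Finset.sum_comm
    _ ≤ ∑ _s : α, exp ((exp l - 1) * ε * K) := by
      refine Finset.sum_le_sum fun s _ => (hgen s _ hc).trans ?_
      rw [mul_comm _ (K : ℝ), exp_nat_mul]
      refine pow_le_pow_left₀ (by positivity) ?_ _
      linarith [add_one_le_exp ((exp l - 1) * ε)]
    _ = 2 ^ S * exp ((exp l - 1) * ε * K) := by simp [hα]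
    _ ≤ _ := by
      rw [exp_add]
      refine mul_le_mul_of_nonneg_right ?_ (exp_pos _).le
      rw [← mul_one (S : ℝ), exp_nat_mul]
      exact pow_le_pow_left₀ (by norm_num) (by linarith [add_one_le_exp 1]) _
  have hlin := exp_le_exp.mp key
  have hmean : ∑ g, p g * (l * ∑ k, Z (adv g) g k) =
      l * K * ∑ g, p g * ((K : ℝ)⁻¹ * ∑ k, Z (adv g) g k) := by
    rw [Finset.mul_sum]
    refine Finset.sum_congr rfl fun g _ => ?_
    field_simp
  rw [hmean] at hlin
  have hbound : (exp l - 1) * ε * K ≤ l * K * (ε + l) := by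
    have h1 : (exp l - 1) * ε ≤ (l + l ^ 2) * ε := mul_le_mul_of_nonneg_right hc' hε0
    have h2 : (l + l ^ 2) * ε ≤ l * (ε + l) := by nlinarith [sq_nonneg l]
    nlinarith
  rw [← mul_le_mul_iff_of_pos_left (mul_pos hl0 hKR), mul_add, mul_div_cancel₀ _ (by positivity)]
  linarith

/-- Optimisation of the free parameter in a bound `ε + l + S / (l * K)`. -/
theorem le_add_four_mul_sqrt (K S : ℕ) (hK : 0 < K) (m ε : ℝ) (hε : 0 ≤ ε) (hm : m ≤ 1)
    (h : ∀ l : ℝ, 0 < l → l ≤ 1 → m ≤ ε + l + S / (l * K)) : m ≤ ε + 4 * √(S / K) := by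
  have hKR : (0 : ℝ) < K := by exact_mod_cast hK
  rcases S.eq_zero_or_pos with rfl | hS
  · simp only [Nat.cast_zero, zero_div, sqrt_zero, mul_zero, add_zero] at h ⊢
    refine le_of_forall_pos_le_add fun δ hδ => ?_
    exact (h (min δ 1) (by positivity) (min_le_right _ _)).trans (by linarith [min_le_left δ 1])
  · have hr : 0 < √((S : ℝ) / K) := sqrt_pos.mpr (by positivity)
    rcases le_total (√((S : ℝ) / K)) 1 with h1 | h1
    · have h2 := h _ hr h1
      have h3 : (S : ℝ) / (√(S / K) * K) = √(S / K) := by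
        have := mul_self_sqrt (show 0 ≤ (S : ℝ) / K by positivity)
        rw [div_eq_iff (by positivity), ← mul_assoc, this]
        field_simp
      linarith
    · linarith

end Real

namespace Game

variable (G : Game)

theorem tsum_π_mul_le_one (f : Fin G.M → Fin G.N) (φ : G.Ch → ℝ≥0∞) (hφ : ∀ ch, φ ch ≤ 1) :
    ∑' ch, G.π f ch * φ ch ≤ 1 := calc
  _ ≤ ∑' ch, G.π f ch := ENNReal.tsum_le_tsum fun ch => mul_le_of_le_one_right' (hφ ch)
  _ = 1 := (G.π f).tsum_coe

theorem detWinProb_le_one {T : ℕ} (a : G.Ch → DT (Fin G.M) (fun _ => Fin G.N) G.Out T) :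
    G.detWinProb a ≤ 1 := calc
  _ ≤ ∑' f, G.μ f := ENNReal.tsum_le_tsum fun f =>
      mul_le_of_le_one_right' (G.tsum_π_mul_le_one f _ fun _ => ind_le_one _)
  _ = 1 := G.μ.tsum_coe

theorem unifSec_le_one (T : ℕ) : G.unifSec T ≤ 1 :=
  iSup_le fun A => calc
    _ ≤ ∑' a, A a := ENNReal.tsum_le_tsum fun a => mul_le_of_le_one_right' (G.detWinProb_le_one a)
    _ = 1 := A.tsum_coe

theorem detWinProb_le_unifSec {T : ℕ} (a : G.Ch → DT (Fin G.M) (fun _ => Fin G.N) G.Out T) :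
    G.detWinProb a ≤ G.unifSec T := by
  refine le_trans (le_of_eq ?_) (le_iSup _ (PMF.pure a))
  rw [tsum_eq_single a fun b hb => by simp [PMF.pure_apply, hb]]
  simp

theorem sum_optVal_one_add_le (T : ℕ) (c : ℝ≥0∞) :
    ∑ ch, DT.optVal (fun f o => 1 + c * ind (o ∈ G.R f ch)) T (fun f => G.μ f * G.π f ch) ≤
      1 + c * G.unifSec T := by
  refine (ENNReal.sum_iSup_le_iSup_sum _ _).trans (iSup_le fun a => ?_)
  refine le_trans (le_of_eq ?_) (add_le_add_right (mul_le_mul_right (G.detWinProb_le_unifSec a) c) 1)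
  have hμ := G.μ.tsum_coe
  have hπ := fun f => (G.π f).tsum_coe
  simp only [tsum_fintype] at hμ hπ
  rw [Finset.sum_comm]
  simp only [detWinProb, tsum_fintype, mul_assoc, mul_add, mul_one, Finset.sum_add_distrib,
    ← Finset.mul_sum, hπ, hμ]
  congr 1
  rw [Finset.mul_sum]
  refine Finset.sum_congr rfl fun f _ => ?_
  simp only [Finset.mul_sum]
  exact Finset.sum_congr rfl fun ch _ => by ring

/-- Winning probability for salt `k` and joint oracle `g` of the deterministic algorithms `a`,
one for each salt and challenge. -/
noncomputable def saltWin {K T : ℕ}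
    (a : Fin K → G.Ch → DT (Fin K × Fin G.M) (fun _ => Fin G.N) G.Out T)
    (g : Fin K → Fin G.M → Fin G.N) (k : Fin K) : ℝ≥0∞ :=
  ∑' ch : G.Ch, G.π (g k) ch * ind ((a k ch).run (fun q => g q.1 q.2) ∈ G.R (g k) ch)

theorem saltWin_le_one {K T : ℕ}
    (a : Fin K → G.Ch → DT (Fin K × Fin G.M) (fun _ => Fin G.N) G.Out T)
    (g : Fin K → Fin G.M → Fin G.N) (k : Fin K) : G.saltWin a g k ≤ 1 :=
  G.tsum_π_mul_le_one _ _ fun _ => ind_le_one _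

/-- The generating function of the number of won salts is dominated by that of a binomial
variable with success probability `ε_G(T)`. -/
theorem sum_prod_one_add_saltWin_le {K T : ℕ}
    (a : Fin K → G.Ch → DT (Fin K × Fin G.M) (fun _ => Fin G.N) G.Out T) (c : ℝ≥0∞) :
    ∑ g : Fin K → Fin G.M → Fin G.N, (∏ k, G.μ (g k)) * ∏ k, (1 + c * G.saltWin a g k) ≤
      (1 + c * G.unifSec T) ^ K := by
  have : Nonempty (Fin G.M) := ⟨⟨0, G.hM⟩⟩
  let _ : Inhabited (Fin G.N) := ⟨⟨0, G.hN⟩⟩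
  let D : G.Ch → (Fin G.M → Fin G.N) → ℝ≥0∞ := fun ch f => G.μ f * G.π f ch
  let w : G.Ch → (Fin G.M → Fin G.N) → G.Out → ℝ≥0∞ := fun ch f o => 1 + c * ind (o ∈ G.R f ch)
  calc
    _ = ∑ g : Fin K → Fin G.M → Fin G.N, ∏ k, ∑ ch,
          (D ch (g k) * w ch (g k) ((a k ch).run fun q => g q.1 q.2)) := by
      refine Finset.sum_congr rfl fun g _ => ?_
      rw [← Finset.prod_mul_distrib]
      refine Finset.prod_congr rfl fun k _ => ?_
      have hπ := (G.π (g k)).tsum_coe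
      rw [tsum_fintype] at hπ
      simp only [D, w, saltWin, tsum_fintype, mul_assoc, ← Finset.mul_sum, mul_add, mul_one,
        Finset.sum_add_distrib, hπ]
      congr 1
      simp only [Finset.mul_sum]
      exact Finset.sum_congr rfl fun ch _ => by ring
    _ = ∑ chs : Fin K → G.Ch, ∑ g : Fin K → Fin G.M → Fin G.N, ∏ k,
          (D (chs k) (g k) * w (chs k) (g k) ((a k (chs k)).run fun q => g q.1 q.2)) := by
      rw [Finset.sum_comm]
      refine Finset.sum_congr rfl fun g _ => ?_
      classical rw [Finset.prod_univ_sum, Fintype.piFinset_univ]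
    _ ≤ ∑ chs : Fin K → G.Ch, ∏ k, DT.optVal (w (chs k)) T (D (chs k)) :=
      Finset.sum_le_sum fun chs _ =>
        DT.sum_prod_le_prod_optVal (fun k => w (chs k)) T (fun k => a k (chs k))
          fun k => D (chs k)
    _ = ∏ _k : Fin K, ∑ ch, DT.optVal (w ch) T (D ch) := by
      classical rw [Finset.prod_univ_sum, Fintype.piFinset_univ]
    _ ≤ ∏ _k : Fin K, (1 + c * G.unifSec T) :=
      Finset.prod_le_prod' fun _ _ => G.sum_optVal_one_add_le T c
    _ = _ := by simp

theorem sum_prod_μ (K : ℕ) : ∑ g : Fin K → Fin G.M → Fin G.N, ∏ k, G.μ (g k) = 1 := by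
  have hμ := G.μ.tsum_coe
  rw [tsum_fintype] at hμ
  rw [← Fintype.piFinset_univ, ← Finset.prod_univ_sum]
  simp [hμ]

/-- The additive bound for deterministic algorithms. -/
theorem sum_saltWin_le (K S T : ℕ) (hK : 0 < K)
    (a : (Fin S → Bool) × Fin K × G.Ch → DT (Fin K × Fin G.M) (fun _ => Fin G.N) G.Out T)
    (adv : (Fin K → Fin G.M → Fin G.N) → Fin S → Bool) :
    ∑ g : Fin K → Fin G.M → Fin G.N, (∏ k, G.μ (g k)) *
        ((K : ℝ≥0∞)⁻¹ * ∑ k, G.saltWin (fun k ch => a (adv g, k, ch)) g k) ≤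
      G.unifSec T + 4 * ((S : ℝ≥0∞) / (K : ℝ≥0∞)) ^ ((1 : ℝ) / 2) := by
  have hKR : (0 : ℝ) < K := by exact_mod_cast hK
  let Z : (Fin S → Bool) → (Fin K → Fin G.M → Fin G.N) → Fin K → ℝ≥0∞ :=
    fun s => G.saltWin fun k ch => a (s, k, ch)
  have hZ1 : ∀ s g k, Z s g k ≤ 1 := fun s g k => G.saltWin_le_one _ _ _
  have hZ : ∀ s g k, Z s g k ≠ ⊤ := fun s g k => ne_top_of_le_ne_top ENNReal.one_ne_top (hZ1 s g k)
  have hε : G.unifSec T ≠ ⊤ := ne_top_of_le_ne_top ENNReal.one_ne_top (G.unifSec_le_one T)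
  have hμ : ∀ g : Fin K → Fin G.M → Fin G.N, ∏ k, G.μ (g k) ≠ ⊤ := fun g =>
    ENNReal.prod_ne_top fun k _ => G.μ.apply_ne_top _
  have hKinv : (K : ℝ≥0∞)⁻¹ ≠ ⊤ := by simpa using hK.ne'
  have hterm : ∀ g, (∏ k, G.μ (g k)) * ((K : ℝ≥0∞)⁻¹ * ∑ k, Z (adv g) g k) ≠ ⊤ := fun g =>
    ENNReal.mul_ne_top (hμ g) (ENNReal.mul_ne_top hKinv (ENNReal.sum_ne_top.mpr fun k _ => hZ _ _ _))
  have hp1 : ∑ g : Fin K → Fin G.M → Fin G.N, (∏ k, G.μ (g k)).toReal = 1 := by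
    rw [← ENNReal.toReal_sum fun g _ => hμ g, G.sum_prod_μ, ENNReal.toReal_one]
  have hm : (∑ g, (∏ k, G.μ (g k)) * ((K : ℝ≥0∞)⁻¹ * ∑ k, Z (adv g) g k)).toReal =
      ∑ g : Fin K → Fin G.M → Fin G.N, (∏ k, G.μ (g k)).toReal *
        ((K : ℝ)⁻¹ * ∑ k, (Z (adv g) g k).toReal) := by
    rw [ENNReal.toReal_sum fun g _ => hterm g]
    refine Finset.sum_congr rfl fun g _ => ?_
    rw [ENNReal.toReal_mul, ENNReal.toReal_mul, ENNReal.toReal_sum fun k _ => hZ _ _ _]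
    simp
  have hZR : ∀ s g k, (Z s g k).toReal ≤ 1 := fun s g k =>
    ENNReal.toReal_le_of_le_ofReal zero_le_one (by simpa using hZ1 s g k)
  have hgen : ∀ s, ∀ c : ℝ, 0 ≤ c → ∑ g : Fin K → Fin G.M → Fin G.N, (∏ k, G.μ (g k)).toReal *
      ∏ k, (1 + c * (Z s g k).toReal) ≤ (1 + c * (G.unifSec T).toReal) ^ K := by
    intro s c hc
    have hfac : ∀ x : ℝ≥0∞, x ≠ ⊤ → (1 + ENNReal.ofReal c * x).toReal = 1 + c * x.toReal := by
      intro x hx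
      rw [ENNReal.toReal_add ENNReal.one_ne_top (ENNReal.mul_ne_top ENNReal.ofReal_ne_top hx),
        ENNReal.toReal_mul, ENNReal.toReal_ofReal hc, ENNReal.toReal_one]
    have hne : ∀ x : ℝ≥0∞, x ≠ ⊤ → 1 + ENNReal.ofReal c * x ≠ ⊤ := fun x hx =>
      ENNReal.add_ne_top.mpr ⟨ENNReal.one_ne_top, ENNReal.mul_ne_top ENNReal.ofReal_ne_top hx⟩
    have h := ENNReal.toReal_mono (ENNReal.pow_ne_top (hne _ hε))
      (G.sum_prod_one_add_saltWin_le (fun k ch => a (s, k, ch)) (ENNReal.ofReal c))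
    rw [ENNReal.toReal_sum fun g _ => ENNReal.mul_ne_top (hμ g)
      (ENNReal.prod_ne_top fun k _ => hne _ (hZ s g k)), ENNReal.toReal_pow, hfac _ hε] at h
    refine le_trans (le_of_eq (Finset.sum_congr rfl fun g _ => ?_)) h
    rw [ENNReal.toReal_mul, ENNReal.toReal_prod, ENNReal.toReal_prod]
    exact congrArg _ (Finset.prod_congr rfl fun k _ => (hfac _ (hZ s g k)).symm)
  have hle := Real.le_add_four_mul_sqrt K S hK _ (G.unifSec T).toReal ENNReal.toReal_nonneg
    (show ∑ g : Fin K → Fin G.M → Fin G.N, (∏ k, G.μ (g k)).toReal *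
        ((K : ℝ)⁻¹ * ∑ k, (Z (adv g) g k).toReal) ≤ 1 by
      rw [← hp1]
      refine Finset.sum_le_sum fun g _ => mul_le_of_le_one_right ENNReal.toReal_nonneg ?_
      rw [inv_mul_le_one₀ hKR]
      simpa using Finset.sum_le_card_nsmul Finset.univ _ 1 fun k _ => hZR (adv g) g k)
    (Real.mean_max_le_of_generating_le K S hK (by simp) _ (fun g => ENNReal.toReal_nonneg) hp1 _
      (fun s g k => ENNReal.toReal_nonneg) hZR _ ENNReal.toReal_nonneg
      (ENNReal.toReal_le_of_le_ofReal zero_le_one (by simpa using G.unifSec_le_one T)) hgen adv)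
  rw [← hm] at hle
  have hsqrt : ((S : ℝ≥0∞) / (K : ℝ≥0∞)) ^ ((1 : ℝ) / 2) = ENNReal.ofReal √(S / K) := by
    rw [Real.sqrt_eq_rpow, ← ENNReal.ofReal_rpow_of_nonneg (by positivity) (by norm_num),
      ENNReal.ofReal_div_of_pos hKR]
    simp
  rw [hsqrt, ← ENNReal.ofReal_toReal (ENNReal.sum_ne_top.mpr fun g _ => hterm g)]
  refine (ENNReal.ofReal_le_ofReal hle).trans (le_of_eq ?_)
  rw [ENNReal.ofReal_add ENNReal.toReal_nonneg (by positivity), ENNReal.ofReal_toReal hε,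
    ENNReal.ofReal_mul (by norm_num)]
  simp

/-- The winning probability of a randomized algorithm is the average over its deterministic
algorithms. -/
theorem saltedWinProb_eq_tsum (K S T : ℕ)
    (A : PMF ((Fin S → Bool) × Fin K × G.Ch →
      DT (Fin K × Fin G.M) (fun _ => Fin G.N) G.Out T))
    (adv : (Fin K → Fin G.M → Fin G.N) → Fin S → Bool) :
    G.saltedWinProb K S T A adv = ∑' a, A a *
      ∑ g : Fin K → Fin G.M → Fin G.N, (∏ k, G.μ (g k)) *
        ((K : ℝ≥0∞)⁻¹ * ∑ k, G.saltWin (fun k ch => a (adv g, k, ch)) g k) := by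
  simp only [saltedWinProb, saltWin, ← tsum_fintype (L := .unconditional _),
    ← ENNReal.tsum_mul_left]
  rw [ENNReal.tsum_comm (α := _ × _ → _)]
  refine tsum_congr fun g => ?_
  rw [ENNReal.tsum_comm (α := _ × _ → _)]
  refine tsum_congr fun k => ?_
  rw [ENNReal.tsum_comm (α := _ × _ → _)]
  exact tsum_congr fun ch => tsum_congr fun a => by ring

end Game

/-- Additive bound: for every game `G`, every `K ∈ ℤ+` and all
`S, T ∈ ℕ`, `ε_{G_K}(S, T) ≤ ε_G(T) + 4·√(S/K)`. -/
theorem salted_nonuniform_le_add (G : Game) (K : ℕ) (hK : 0 < K) (S T : ℕ) :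
    G.saltedNonunifSec K S T ≤
      G.unifSec T + 4 * ((S : ℝ≥0∞) / (K : ℝ≥0∞)) ^ ((1 : ℝ) / 2) := by
  refine iSup₂_le fun A adv => ?_
  rw [G.saltedWinProb_eq_tsum]
  calc
    _ ≤ ∑' a, A a * (G.unifSec T + 4 * ((S : ℝ≥0∞) / (K : ℝ≥0∞)) ^ ((1 : ℝ) / 2)) :=
      ENNReal.tsum_le_tsum fun a => mul_le_mul_right (G.sum_saltWin_le K S T hK a adv) _
    _ = _ := by rw [ENNReal.tsum_mul_right, A.tsum_coe, one_mul]
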